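/- Let r > 0, 0 < λ < 2r, ρ ∈ 𝒫_{2r}, ξ ∈ 𝒞_r and t ≥ 0, and let x : ℝ → ℝⁿ be continuous with x(u) = ξ(u) for all u ≤ 0. Then ∫_0^t e^{λs} ( ∫_{−∞}^0 |x(s+u)|² ρ(du) ) ds ≤ ‖ξ‖_r² ρ^{(2r)} / (2r − λ) + ρ^{(λ)} ∫_0^t e^{λs} |x(s)|² ds. -/

import Mathlib

open MeasureTheory Filter Set

noncomputable section

/-- Euclidean norm on `Fin n → ℝ`. -/
def vnorm {n : ℕ} (x : Fin n → ℝ) : ℝ := Real.sqrt (∑ i, x i ^ 2)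

/-- The weighted sup-norm `‖φ‖_r = sup_{u ≤ 0} e^{r u} |φ(u)|`. -/
def crNorm (r : ℝ) {n : ℕ} (φ : ℝ → Fin n → ℝ) : ℝ :=
  sSup ((fun u => Real.exp (r * u) * vnorm (φ u)) '' Set.Iic 0)

/-- Membership in the phase space `𝒞_r`. -/
def MemCr (r : ℝ) {n : ℕ} (φ : ℝ → Fin n → ℝ) : Prop :=
  ContinuousOn φ (Set.Iic 0) ∧
    BddAbove ((fun u => Real.exp (r * u) * vnorm (φ u)) '' Set.Iic 0)

lemma continuous_vnorm {n : ℕ} : Continuous (vnorm : (Fin n → ℝ) → ℝ) := by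
  unfold vnorm
  fun_prop

lemma vnorm_nonneg {n : ℕ} (x : Fin n → ℝ) : 0 ≤ vnorm x := Real.sqrt_nonneg _

lemma MemCr.sq_vnorm_le {r : ℝ} {n : ℕ} {φ : ℝ → Fin n → ℝ} (hφ : MemCr r φ) {u : ℝ}
    (hu : u ≤ 0) : vnorm (φ u) ^ 2 ≤ crNorm r φ ^ 2 * Real.exp (-(2 * r * u)) := by
  have h : Real.exp (r * u) * vnorm (φ u) ≤ crNorm r φ := le_csSup hφ.2 ⟨u, hu, rfl⟩
  have h2 : (Real.exp (r * u) * vnorm (φ u)) ^ 2 ≤ crNorm r φ ^ 2 :=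
    pow_le_pow_left₀ (mul_nonneg (Real.exp_pos _).le (vnorm_nonneg _)) h 2
  calc vnorm (φ u) ^ 2
      = (Real.exp (r * u) * vnorm (φ u)) ^ 2 * Real.exp (-(2 * r * u)) := by
        rw [mul_pow, ← Real.exp_nat_mul, mul_right_comm, ← Real.exp_add]
        have : ((2 : ℕ) : ℝ) * (r * u) + -(2 * r * u) = 0 := by push_cast; ring
        rw [this, Real.exp_zero, one_mul]
    _ ≤ _ := mul_le_mul_of_nonneg_right h2 (Real.exp_pos _).le

lemma integral_exp_mul_le {c u : ℝ} (hc : 0 < c) :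
    ∫ v in u..0, Real.exp (-(c * v)) ≤ Real.exp (-(c * u)) / c := by
  have h : ∀ v ∈ uIcc u 0,
      HasDerivAt (fun v => -(Real.exp (-(c * v)) / c)) (Real.exp (-(c * v))) v := by
    intro v _
    have := ((((hasDerivAt_id v).const_mul c).neg.exp).div_const c).neg
    refine this.congr_deriv ?_
    simp only [id, Pi.neg_apply]
    field_simp
  rw [intervalIntegral.integral_eq_sub_of_hasDerivAt h
    (Continuous.intervalIntegrable (by fun_prop) _ _)]
  have : 0 ≤ 1 / c := by positivity
  simp only [mul_zero, neg_zero, Real.exp_zero]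
  linarith

/-- The fading-memory estimate along a single delay `u ≤ 0`. -/
lemma integral_exp_mul_shift_le {r lam t K u : ℝ} (hlam : lam < 2 * r) (ht : 0 ≤ t)
    {g : ℝ → ℝ} (hg : Continuous g) (hg0 : ∀ v, 0 ≤ g v)
    (hgK : ∀ v ≤ 0, g v ≤ K * Real.exp (-(2 * r * v))) (hK : 0 ≤ K) (hu : u ≤ 0) :
    ∫ s in (0 : ℝ)..t, Real.exp (lam * s) * g (s + u)
      ≤ K / (2 * r - lam) * Real.exp (-(2 * r * u))
        + Real.exp (-(lam * u)) * ∫ s in (0 : ℝ)..t, Real.exp (lam * s) * g s := by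
  have hint : ∀ a b : ℝ, IntervalIntegrable (fun s => Real.exp (lam * s) * g s) volume a b :=
    fun a b => Continuous.intervalIntegrable (by fun_prop) _ _
  have hc : 0 < 2 * r - lam := by linarith
  have hshift : ∫ s in (0 : ℝ)..t, Real.exp (lam * s) * g (s + u)
      = Real.exp (-(lam * u)) * ∫ v in u..(t + u), Real.exp (lam * v) * g v := by
    have := intervalIntegral.integral_comp_add_right (a := 0) (b := t)
      (fun v => Real.exp (lam * v) * g v) u
    rw [zero_add] at this
    rw [← this, ← intervalIntegral.integral_const_mul]
    congr 1 with s
    rw [← mul_assoc, ← Real.exp_add]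
    ring_nf
  have hmono : ∫ v in u..(t + u), Real.exp (lam * v) * g v
      ≤ ∫ v in u..t, Real.exp (lam * v) * g v :=
    intervalIntegral.integral_mono_interval le_rfl (by linarith) (by linarith)
      (ae_of_all _ fun v => mul_nonneg (Real.exp_pos _).le (hg0 v)) (hint _ _)
  have hsplit := intervalIntegral.integral_add_adjacent_intervals (hint u 0) (hint 0 t)
  have hpast : ∫ v in u..0, Real.exp (lam * v) * g v
      ≤ K * (Real.exp (-((2 * r - lam) * u)) / (2 * r - lam)) := by
    refine le_trans ?_ (mul_le_mul_of_nonneg_left (integral_exp_mul_le hc) hK)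
    rw [← intervalIntegral.integral_const_mul]
    refine intervalIntegral.integral_mono_on hu (hint _ _)
      (Continuous.intervalIntegrable (by fun_prop) _ _) fun v hv => ?_
    calc Real.exp (lam * v) * g v
        ≤ Real.exp (lam * v) * (K * Real.exp (-(2 * r * v))) :=
          mul_le_mul_of_nonneg_left (hgK v hv.2) (Real.exp_pos _).le
      _ = K * Real.exp (-((2 * r - lam) * v)) := by
          rw [mul_left_comm, ← Real.exp_add]
          ring_nf
  have hexp : Real.exp (-(2 * r * u))
      = Real.exp (-(lam * u)) * Real.exp (-((2 * r - lam) * u)) := by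
    rw [← Real.exp_add]
    ring_nf
  calc _ ≤ Real.exp (-(lam * u)) * (K * (Real.exp (-((2 * r - lam) * u)) / (2 * r - lam))
        + ∫ s in (0 : ℝ)..t, Real.exp (lam * s) * g s) := by
        rw [hshift]
        exact mul_le_mul_of_nonneg_left (by linarith) (Real.exp_pos _).le
    _ = _ := by
        rw [hexp]
        ring

lemma integrable_exp_mul_shift {r lam t K : ℝ} (hr : 0 < r) (hlam0 : 0 < lam)
    {ρ : Measure ℝ} [IsProbabilityMeasure ρ] (hsupp : ∀ᵐ u ∂ρ, u ≤ 0)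
    (hmom : Integrable (fun u => Real.exp (-(2 * r * u))) ρ)
    {g : ℝ → ℝ} (hg : Continuous g) (hg0 : ∀ v, 0 ≤ g v)
    (hgK : ∀ v ≤ 0, g v ≤ K * Real.exp (-(2 * r * v))) (hK : 0 ≤ K) :
    Integrable (Function.uncurry fun s u => Real.exp (lam * s) * g (s + u))
      ((volume.restrict (Ioc 0 t)).prod ρ) := by
  obtain ⟨M, hM⟩ := (isCompact_Icc (a := (0 : ℝ)) (b := t)).bddAbove_image hg.continuousOn
  refine ((hmom.comp_snd (volume.restrict (Ioc 0 t))).const_mul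
    (Real.exp (lam * t) * (K + |M|))).mono'
    (Continuous.aestronglyMeasurable (by unfold Function.uncurry; fun_prop)) ?_
  filter_upwards [Measure.quasiMeasurePreserving_fst.ae (ae_restrict_mem measurableSet_Ioc),
    Measure.quasiMeasurePreserving_snd.ae hsupp] with ⟨s, u⟩ hs hu
  simp only [Function.uncurry] at hs hu ⊢
  rw [Real.norm_of_nonneg (mul_nonneg (Real.exp_pos _).le (hg0 _)), mul_assoc]
  have hexp : Real.exp (lam * s) ≤ Real.exp (lam * t) :=
    Real.exp_le_exp.2 (mul_le_mul_of_nonneg_left hs.2 hlam0.le)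
  have hone : 1 ≤ Real.exp (-(2 * r * u)) := Real.one_le_exp (by nlinarith)
  refine mul_le_mul hexp ?_ (hg0 _) (Real.exp_pos _).le
  rcases le_total (s + u) 0 with h | h
  · have h1 : Real.exp (-(2 * r * (s + u))) ≤ Real.exp (-(2 * r * u)) :=
      Real.exp_le_exp.2 (by nlinarith [hs.1])
    calc g (s + u) ≤ K * Real.exp (-(2 * r * (s + u))) := hgK _ h
      _ ≤ (K + |M|) * Real.exp (-(2 * r * u)) := by
        gcongr
        linarith [abs_nonneg M]
  · have h1 : g (s + u) ≤ M := hM ⟨s + u, ⟨h, by linarith [hs.2]⟩, rfl⟩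
    calc g (s + u) ≤ K + |M| := by linarith [le_abs_self M]
      _ ≤ (K + |M|) * Real.exp (-(2 * r * u)) := le_mul_of_one_le_right (by positivity) hone

/-- The fading-memory estimate used in the stability analysis: for `0 < λ < 2r`,
`ρ ∈ 𝒫_{2r}` and a continuous path `x` equal to `ξ ∈ 𝒞_r` on `(-∞,0]`,
`∫_0^t e^{λ s} ∫_{-∞}^0 |x(s+u)|² ρ(du) ds
  ≤ ‖ξ‖_r² ρ^{(2r)} / (2r-λ) + ρ^{(λ)} ∫_0^t e^{λ s} |x(s)|² ds`. -/
theorem fading_memory_estimate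
    (r lam : ℝ) (hr : 0 < r) (hlam0 : 0 < lam) (hlam : lam < 2 * r)
    (nd : ℕ)
    (ρ : Measure ℝ) [IsProbabilityMeasure ρ] (hsupp : ρ (Set.Ioi 0) = 0)
    (hmom : Integrable (fun u => Real.exp (-(2 * r * u))) ρ)
    (ξ : ℝ → Fin nd → ℝ) (hξ : MemCr r ξ)
    (t : ℝ) (ht : 0 ≤ t)
    (x : ℝ → Fin nd → ℝ) (hxcont : Continuous x)
    (hxinit : ∀ u : ℝ, u ≤ 0 → x u = ξ u) :
    ∫ s in (0:ℝ)..t, Real.exp (lam * s) * ∫ u, (vnorm (x (s + u))) ^ 2 ∂ρ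
      ≤ (crNorm r ξ) ^ 2 * (∫ u, Real.exp (-(2 * r * u)) ∂ρ) / (2 * r - lam)
        + (∫ u, Real.exp (-(lam * u)) ∂ρ)
            * ∫ s in (0:ℝ)..t, Real.exp (lam * s) * (vnorm (x s)) ^ 2 := by
  set g : ℝ → ℝ := fun v => vnorm (x v) ^ 2 with hgdef
  have hg : Continuous g := (continuous_vnorm.comp hxcont).pow 2
  have hg0 : ∀ v, 0 ≤ g v := fun v => sq_nonneg _
  have hgK : ∀ v ≤ 0, g v ≤ crNorm r ξ ^ 2 * Real.exp (-(2 * r * v)) := by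
    intro v hv
    simp only [hgdef, hxinit v hv]
    exact hξ.sq_vnorm_le hv
  have hsupp' : ∀ᵐ u ∂ρ, u ≤ 0 := by
    simpa only [ae_iff, not_le, Ioi_def] using hsupp
  have hint := integrable_exp_mul_shift (t := t) hr hlam0 hsupp' hmom hg hg0 hgK (sq_nonneg _)
  have hmom' : Integrable (fun u => Real.exp (-(lam * u))) ρ := by
    refine hmom.mono' (Continuous.aestronglyMeasurable (by fun_prop)) ?_
    filter_upwards [hsupp'] with u hu
    rw [Real.norm_of_nonneg (Real.exp_pos _).le]
    exact Real.exp_le_exp.2 (by nlinarith)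
  calc ∫ s in (0:ℝ)..t, Real.exp (lam * s) * ∫ u, g (s + u) ∂ρ
      = ∫ u, (∫ s in (0:ℝ)..t, Real.exp (lam * s) * g (s + u)) ∂ρ := by
        simp only [intervalIntegral.integral_of_le ht, ← integral_const_mul]
        exact integral_integral_swap hint
    _ ≤ ∫ u, (crNorm r ξ ^ 2 / (2 * r - lam) * Real.exp (-(2 * r * u))
          + Real.exp (-(lam * u)) * ∫ s in (0:ℝ)..t, Real.exp (lam * s) * g s) ∂ρ := by
        refine integral_mono_ae ?_ ((hmom.const_mul _).add (hmom'.mul_const _)) ?_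
        · simp only [intervalIntegral.integral_of_le ht]
          exact hint.integral_prod_right
        · filter_upwards [hsupp'] with u hu
          exact integral_exp_mul_shift_le hlam ht hg hg0 hgK (sq_nonneg _) hu
    _ = _ := by
        rw [integral_add (hmom.const_mul _) (hmom'.mul_const _), integral_const_mul,
          integral_mul_const]
        ring
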